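/- arXiv:1611.09096 — 2 statements merged into one kernel-verified Lean document; each statement's English description precedes it below -/
import Mathlib

section
/- Let P = {v_0, v_1, …, v_{n−1}} be a set of n ≥ 3 points in convex position in the plane, and let C be a 1-plane Hamiltonian cycle on P that contains a diagonal edge v_i v_j. If one of the two parts of P determined by v_i v_j has an even number of points, then C contains at least two distinct boundary edges both of whose endpoints lie in that part. -/
open Finset

noncomputable section

/-- The Euclidean plane. -/
abbrev Pt : Type := EuclideanSpace ℝ (Fin 2)

/-- Strict counterclockwise orientation of an ordered triple of points. -/
def Ccw (p q r : Pt) : Prop :=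
  0 < (q 0 - p 0) * (r 1 - p 1) - (q 1 - p 1) * (r 0 - p 0)

/-- `v` lists `n` points in convex position, labeled counterclockwise. -/
def ConvexCcw {n : ℕ} (v : Fin n → Pt) : Prop :=
  ∀ i j k : Fin n, i < j → j < k → Ccw (v i) (v j) (v k)

/-- The open straight-line segment drawn for an unordered pair of indices. -/
def seg {n : ℕ} (v : Fin n → Pt) (e : Sym2 (Fin n)) : Set Pt :=
  Sym2.lift ⟨fun a b => openSegment ℝ (v a) (v b),
    fun a b => openSegment_symm ℝ (v a) (v b)⟩ e

/-- Two drawn edges cross: they share no endpoint and their open segments meet. -/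
def EdgesCross {n : ℕ} (v : Fin n → Pt) (e f : Sym2 (Fin n)) : Prop :=
  (∀ a, a ∈ e → a ∉ f) ∧ (seg v e ∩ seg v f).Nonempty

/-- A set of drawn edges is 1-plane: each edge is crossed by at most one other edge. -/
def OnePlane {n : ℕ} (v : Fin n → Pt) (E : Set (Sym2 (Fin n))) : Prop :=
  ∀ e ∈ E, {f | f ∈ E ∧ EdgesCross v e f}.Subsingleton

/-- `σ` is a Hamiltonian cycle on all `n` vertices. -/
def IsHamCycle {n : ℕ} (σ : Equiv.Perm (Fin n)) : Prop :=
  σ.IsCycle ∧ σ.support = Finset.univ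

/-- The edge set of the Hamiltonian cycle `σ`. -/
def cycEdges {n : ℕ} (σ : Equiv.Perm (Fin n)) : Set (Sym2 (Fin n)) :=
  {e | ∃ i : Fin n, e = s(i, σ i)}

/-- `σ` is a 1-plane Hamiltonian cycle for the point placement `v`. -/
def IsOnePlaneHC {n : ℕ} (v : Fin n → Pt) (σ : Equiv.Perm (Fin n)) : Prop :=
  IsHamCycle σ ∧ OnePlane v (cycEdges σ)

/-- `k` lies on the counterclockwise arc from `j` to `i` (inclusive), indices mod `n`. -/
def InArc {n : ℕ} (j i k : Fin n) : Prop := (k - j).val ≤ (i - j).val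

/-- The pairs of positions `a, b` and `c, d` alternate on a line. -/
def Alt (a b c d : ℕ) : Prop :=
  ((a < c ∧ c < b ∨ b < c ∧ c < a) ∧ (d < a ∧ d < b ∨ a < d ∧ b < d)) ∨
  ((a < d ∧ d < b ∨ b < d ∧ d < a) ∧ (c < a ∧ c < b ∨ a < c ∧ b < c))

lemma Alt.symm {a b c d : ℕ} (h : Alt a b c d) : Alt c d a b := by
  unfold Alt at *; omega

/-- The open diagonals of a convex quadrilateral meet. -/
lemma openSegment_inter_nonempty {a b c d : Pt} (habc : Ccw a b c) (hacd : Ccw a c d)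
    (habd : Ccw a b d) (hbcd : Ccw b c d) :
    (openSegment ℝ a c ∩ openSegment ℝ b d).Nonempty := by
  unfold Ccw at *
  set A := (b 0 - a 0) * (c 1 - a 1) - (b 1 - a 1) * (c 0 - a 0) with hA
  set B := (c 0 - a 0) * (d 1 - a 1) - (c 1 - a 1) * (d 0 - a 0) with hB
  set C := (b 0 - a 0) * (d 1 - a 1) - (b 1 - a 1) * (d 0 - a 0) with hC
  set D := (c 0 - b 0) * (d 1 - b 1) - (c 1 - b 1) * (d 0 - b 0) with hD
  have hsum : D + C = B + A := by rw [hA, hB, hC, hD]; ring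
  have hpos : 0 < B + A := by linarith
  refine ⟨(D / (B + A)) • a + (C / (B + A)) • c,
    ⟨D / (B + A), C / (B + A), by positivity, by positivity, ?_, rfl⟩,
    ⟨B / (B + A), A / (B + A), by positivity, by positivity, ?_, ?_⟩⟩
  · rw [← add_div, hsum, div_self hpos.ne']
  · rw [← add_div, div_self hpos.ne']
  · ext t
    simp only [PiLp.add_apply, PiLp.smul_apply, smul_eq_mul]
    field_simp
    rw [hA, hB, hC, hD]
    fin_cases t <;> simp <;> ring

/-- Counterclockwise order may be read off starting from any vertex `j`. -/
lemma ConvexCcw.ccw_of_val_sub_lt {n : ℕ} {v : Fin n → Pt} (hv : ConvexCcw v) (j : Fin n)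
    {x y z : Fin n} (hxy : (x - j).val < (y - j).val) (hyz : (y - j).val < (z - j).val) :
    Ccw (v x) (v y) (v z) := by
  have key : ∀ t : Fin n, (t - j).val = if j.val ≤ t.val then t.val - j.val
      else n + t.val - j.val := by
    intro t
    split_ifs with h
    · exact Fin.sub_val_of_le h
    · exact (Fin.coe_sub_iff_lt.2 (not_le.1 h)).trans (by omega)
  rw [key, key] at hxy hyz
  have hx := x.isLt
  have hy := y.isLt
  have hz := z.isLt
  have : (x < y ∧ y < z) ∨ (y < z ∧ z < x) ∨ (z < x ∧ x < y) := by
    simp only [Fin.lt_def]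
    split_ifs at hxy hyz <;> omega
  rcases this with ⟨h1, h2⟩ | ⟨h1, h2⟩ | ⟨h1, h2⟩ <;>
  · have := hv _ _ _ h1 h2
    unfold Ccw at *
    linarith

lemma ConvexCcw.edgesCross_of_alt {n : ℕ} {v : Fin n → Pt} (hv : ConvexCcw v) (j : Fin n)
    {a b c d : Fin n} (h : Alt (a - j).val (b - j).val (c - j).val (d - j).val) :
    EdgesCross v s(a, b) s(c, d) := by
  have main : ∀ {a b c d : Fin n}, (a - j).val < (b - j).val → (b - j).val < (c - j).val →
      (c - j).val < (d - j).val →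
      (openSegment ℝ (v a) (v c) ∩ openSegment ℝ (v b) (v d)).Nonempty :=
    fun h1 h2 h3 => openSegment_inter_nonempty (hv.ccw_of_val_sub_lt j h1 h2)
      (hv.ccw_of_val_sub_lt j (h1.trans h2) h3) (hv.ccw_of_val_sub_lt j h1 (h2.trans h3))
      (hv.ccw_of_val_sub_lt j h2 h3)
  refine ⟨?_, ?_⟩
  · intro t ht ht'
    simp only [Sym2.mem_iff] at ht ht'
    unfold Alt at h
    rcases ht with rfl | rfl <;> rcases ht' with rfl | rfl <;> omega
  · change (openSegment ℝ (v a) (v b) ∩ openSegment ℝ (v c) (v d)).Nonempty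
    rcases h with ⟨h1 | h1, h2 | h2⟩ | ⟨h1 | h1, h2 | h2⟩
    · rw [Set.inter_comm, openSegment_symm ℝ (v c)]
      exact main h2.1 h1.1 h1.2
    · exact main h1.1 h1.2 h2.2
    · rw [Set.inter_comm, openSegment_symm ℝ (v c), openSegment_symm ℝ (v a)]
      exact main h2.2 h1.1 h1.2
    · rw [openSegment_symm ℝ (v a)]
      exact main h1.1 h1.2 h2.1
    · rw [Set.inter_comm]
      exact main h2.1 h1.1 h1.2
    · rw [openSegment_symm ℝ (v c)]
      exact main h1.1 h1.2 h2.2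
    · rw [Set.inter_comm, openSegment_symm ℝ (v a)]
      exact main h2.2 h1.1 h1.2
    · rw [openSegment_symm ℝ (v a), openSegment_symm ℝ (v c)]
      exact main h1.1 h1.2 h2.1

section Combinatorics

variable {V : Type*} {n r : ℕ} {p : V → ℕ} {σ : Equiv.Perm V}

/-- In a Hamiltonian cycle, every diagonal is crossed by some edge. -/
lemma exists_alt (hsurj : ∀ t < n, ∃ x, p x = t) (hinj : Function.Injective p)
    (hne : ∀ x, σ (σ x) ≠ x)
    (htr : ∀ S : V → Prop, (∀ x, S x → S (σ x)) → (∃ x, S x) → ∀ x, S x)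
    (hlt : ∀ x, p x < n) {x : V}
    (hlo : p x + 2 ≤ p (σ x) ∨ p (σ x) + 2 ≤ p x)
    (hhi : p x + 2 ≤ p (σ x) + n ∧ p (σ x) + 2 ≤ p x + n) :
    ∃ y, Alt (p x) (p (σ x)) (p y) (p (σ y)) := by
  by_contra! hno
  have hx := hlt x
  have hsx := hlt (σ x)
  have hps : ∀ z, p z = p x → p (σ z) = p (σ x) := fun z hz => by rw [hinj hz]
  have hpss : ∀ z, p z = p (σ x) → p (σ z) = p (σ (σ x)) := fun z hz => by rw [hinj hz]
  have h2 : p (σ (σ x)) ≠ p x := fun h => hne x (hinj h)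
  have h3 : p (σ (σ x)) ≠ p (σ x) := fun h => by
    have := σ.injective (hinj h)
    exact hne x (by rw [this, this])
  unfold Alt at hno
  by_cases hin : (p x < p (σ (σ x)) ∧ p (σ (σ x)) < p (σ x)) ∨
      (p (σ x) < p (σ (σ x)) ∧ p (σ (σ x)) < p x)
  · have hall := htr (fun z => (p x ≤ p z ∧ p z ≤ p (σ x)) ∨ (p (σ x) ≤ p z ∧ p z ≤ p x))
      (fun z hz => by
        have := hps z
        have := hpss z
        have := hno z
        omega) ⟨x, by omega⟩
    obtain ⟨t, ht, ht'⟩ : ∃ t < n, (t < p x ∧ t < p (σ x)) ∨ (p x < t ∧ p (σ x) < t) := by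
      by_cases h : p x = 0 ∨ p (σ x) = 0
      · exact ⟨n - 1, by omega, by omega⟩
      · exact ⟨0, by omega, by omega⟩
    obtain ⟨z, rfl⟩ := hsurj t ht
    have := hall z
    omega
  · have hall := htr (fun z => (p z ≤ p x ∧ p z ≤ p (σ x)) ∨ (p x ≤ p z ∧ p (σ x) ≤ p z))
      (fun z hz => by
        have := hps z
        have := hpss z
        have := hno z
        omega) ⟨x, by omega⟩
    obtain ⟨z, hz⟩ := hsurj (min (p x) (p (σ x)) + 1) (by omega)
    have := hall z
    omega

/-- The edge after the chord `{0, r}` leaves the arc `{0, …, r}`. -/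
lemma lt_apply_apply_of_inner (hsurj : ∀ t < n, ∃ x, p x = t)
    (hinj : Function.Injective p)
    (htr : ∀ S : V → Prop, (∀ x, S x → S (σ x)) → (∃ x, S x) → ∀ x, S x)
    (hrn : r + 2 ≤ n) {a : V}
    (ha : (p a = 0 ∧ p (σ a) = r) ∨ (p a = r ∧ p (σ a) = 0))
    (hinner : ∀ x, 0 < p x → p x < r → p (σ x) ≤ r) :
    r < p (σ (σ a)) := by
  have hpa : ∀ z, p z = p a → p (σ z) = p (σ a) := fun z hz => by rw [hinj hz]
  have hpsa : ∀ z, p z = p (σ a) → p (σ z) = p (σ (σ a)) := fun z hz => by rw [hinj hz]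
  by_contra! hle
  have hall := htr (fun z => p z ≤ r) (fun z hz => by
    have := hpa z
    have := hpsa z
    have := hinner z
    omega) ⟨a, by omega⟩
  obtain ⟨z, hz⟩ := hsurj (n - 1) (by omega)
  have := hall z
  omega

/-- An edge of least length starting inside the arc `{0, …, r}` joins consecutive vertices. -/
lemma exists_short_of_inner [Fintype V] (hsurj : ∀ t < n, ∃ x, p x = t)
    (hinj : Function.Injective p) (hne : ∀ x, σ (σ x) ≠ x)
    (huniq : ∀ x y z, Alt (p x) (p (σ x)) (p y) (p (σ y)) →
      Alt (p x) (p (σ x)) (p z) (p (σ z)) → y = z)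
    (hr2 : 2 ≤ r) (hrn : r + 2 ≤ n) {a : V}
    (ha : (p a = 0 ∧ p (σ a) = r) ∨ (p a = r ∧ p (σ a) = 0))
    (hinner : ∀ x, 0 < p x → p x < r → p (σ x) ≤ r) (hexit : r < p (σ (σ a))) :
    ∃ x, 0 < p x ∧ p x < r ∧ (p x + 1 = p (σ x) ∨ p (σ x) + 1 = p x) := by
  have hσne : ∀ x, p (σ x) ≠ p x := fun x h => hne x (by rw [hinj h, hinj h])
  have hpa : ∀ z, p z = p a → p (σ z) = p (σ a) := fun z hz => by rw [hinj hz]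
  have hpsa : ∀ z, p z = p (σ a) → p (σ z) = p (σ (σ a)) := fun z hz => by rw [hinj hz]
  set T : Finset V := univ.filter fun x => 0 < p x ∧ p x < r with hT
  have hTmem : ∀ x, x ∈ T ↔ 0 < p x ∧ p x < r := by simp [hT]
  have hTne : T.Nonempty := by
    obtain ⟨x, hx⟩ := hsurj 1 (by omega)
    exact ⟨x, (hTmem x).2 (by omega)⟩
  obtain ⟨x, hxT, hmin⟩ := exists_min_image T
    (fun x => max (p x) (p (σ x)) - min (p x) (p (σ x))) hTne
  rw [hTmem] at hxT
  refine ⟨x, hxT.1, hxT.2, ?_⟩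
  by_contra hxs
  have h1 := hinner x hxT.1 hxT.2
  have h2 := hσne x
  obtain ⟨u, hu⟩ := hsurj (min (p x) (p (σ x)) + 1) (by omega)
  have huT : u ∈ T := by
    rw [hTmem]
    omega
  have hminu := hmin u huT
  have hσu := hσne u
  have hux : p (σ u) ≠ p x := by omega
  have hout : Alt (p x) (p (σ x)) (p u) (p (σ u)) := by
    unfold Alt
    omega
  obtain ⟨w, rfl⟩ := σ.surjective u
  have hnot : ¬ Alt (p x) (p (σ x)) (p w) (p (σ w)) := fun h => by
    have := huniq x _ _ h hout
    exact hσne w (by rw [← this])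
  have hwx : p w ≠ p x := fun h => by
    rw [hinj h] at hu
    omega
  have hw1 := hσne w
  have hwa := hpa w
  have hwsa := hpsa w
  rw [hTmem] at huT
  have hwin : min (p x) (p (σ x)) ≤ p w ∧ p w ≤ max (p x) (p (σ x)) := by
    clear hwa hwsa hpa hpsa ha hminu hout
    unfold Alt at hnot
    omega
  have hwT : ¬ (0 < p w ∧ p w < r) := fun h => by
    have := hmin w ((hTmem w).2 h)
    clear hwa hwsa hpa hpsa ha hminu hout hnot
    omega
  clear hnot hout hminu
  omega

/-- The combinatorial core, for an orientation of the cycle along which no edge leaves the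
arc `{0, …, r}` from one of its inner vertices. -/
lemma exists_two_short_of_inner [Fintype V] (hsurj : ∀ t < n, ∃ x, p x = t)
    (hinj : Function.Injective p) (hne : ∀ x, σ (σ x) ≠ x)
    (htr : ∀ S : V → Prop, (∀ x, S x → S (σ x)) → (∃ x, S x) → ∀ x, S x)
    (hlt : ∀ x, p x < n)
    (huniq : ∀ x y z, Alt (p x) (p (σ x)) (p y) (p (σ y)) →
      Alt (p x) (p (σ x)) (p z) (p (σ z)) → y = z)
    (hr2 : 2 ≤ r) (hrn : r + 2 ≤ n) (heven : Even (r + 1)) {a : V}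
    (ha : (p a = 0 ∧ p (σ a) = r) ∨ (p a = r ∧ p (σ a) = 0))
    (hinner : ∀ x, 0 < p x → p x < r → p (σ x) ≤ r) :
    ∃ x y, x ≠ y ∧ (p x ≤ r ∧ p (σ x) ≤ r ∧ (p x + 1 = p (σ x) ∨ p (σ x) + 1 = p x)) ∧
      (p y ≤ r ∧ p (σ y) ≤ r ∧ (p y + 1 = p (σ y) ∨ p (σ y) + 1 = p y)) := by
  classical
  have hσne : ∀ x, p (σ x) ≠ p x := fun x h => hne x (by rw [hinj h, hinj h])
  have hpa : ∀ z, p z = p a → p (σ z) = p (σ a) := fun z hz => by rw [hinj hz]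
  have hpsa : ∀ z, p z = p (σ a) → p (σ z) = p (σ (σ a)) := fun z hz => by rw [hinj hz]
  have hexit := lt_apply_apply_of_inner hsurj hinj htr hrn ha hinner
  set T : Finset V := univ.filter fun x => 0 < p x ∧ p x < r with hT
  have hTmem : ∀ x, x ∈ T ↔ 0 < p x ∧ p x < r := by simp [hT]
  have hTcard : T.card = r - 1 := by
    have : T.image p = Finset.Ioo 0 r := by
      ext t
      simp only [mem_image, hTmem, mem_Ioo]
      constructor
      · rintro ⟨x, hx, rfl⟩
        exact hx
      · intro ht
        obtain ⟨x, rfl⟩ := hsurj t (by omega)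
        exact ⟨x, ht, rfl⟩
    rw [← card_image_of_injective T hinj, this, Nat.card_Ioo]
    omega
  let short : V → Prop := fun x => p x + 1 = p (σ x) ∨ p (σ x) + 1 = p x
  have hpartner : ∀ x ∈ T.filter (fun x => ¬ short x),
      ∃ y, y ∈ T.filter (fun x => ¬ short x) ∧ Alt (p x) (p (σ x)) (p y) (p (σ y)) := by
    intro x hx
    obtain ⟨hxT, hxs⟩ := mem_filter.1 hx
    rw [hTmem] at hxT
    simp only [short] at hxs
    have h1 := hinner x hxT.1 hxT.2
    have h2 := hσne x
    obtain ⟨y, hy⟩ := exists_alt hsurj hinj hne htr hlt (x := x) (by omega) (by omega)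
    refine ⟨y, ?_, hy⟩
    have hya := hpa y
    have hysa := hpsa y
    have hcross : ¬ Alt (p y) (p (σ y)) (p a) (p (σ a)) := fun h => by
      have := huniq y x a hy.symm h
      rw [this] at hxT
      omega
    have hyT : 0 < p y ∧ p y < r := by
      unfold Alt at hcross
      rcases hy with ⟨h | h, h' | h'⟩ | ⟨h | h, h' | h'⟩ <;> omega
    refine mem_filter.2 ⟨(hTmem y).2 hyT, ?_⟩
    simp only [short]
    unfold Alt at hy
    omega
  choose! g hgmem hg using hpartner
  have hDeven : Even (T.filter (fun x => ¬ short x)).card := by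
    have := Finset.sum_involution (s := T.filter (fun x => ¬ short x))
      (f := fun _ => (1 : ZMod 2)) (fun x _ => g x) (fun _ _ => by decide)
      (fun x hx _ h => by
        have := hg x hx
        rw [h] at this
        unfold Alt at this
        omega)
      (fun x hx => hgmem x hx)
      (fun x hx => huniq (g x) _ _ (hg _ (hgmem x hx)) (hg x hx).symm)
    rw [sum_const, nsmul_eq_mul, mul_one] at this
    exact (ZMod.natCast_eq_zero_iff_even).1 this
  have hSeven : Even (T.filter short).card := by
    have h := card_filter_add_card_filter_not (s := T) short
    rw [hTcard] at h
    rw [Nat.even_iff] at *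
    omega
  have hSne : (T.filter short).Nonempty := by
    obtain ⟨x, hx0, hxr, hx⟩ :=
      exists_short_of_inner hsurj hinj hne huniq hr2 hrn ha hinner hexit
    exact ⟨x, mem_filter.2 ⟨(hTmem x).2 ⟨hx0, hxr⟩, hx⟩⟩
  have hcard : 1 < (T.filter short).card := by
    have := card_pos.2 hSne
    rw [Nat.even_iff] at hSeven
    omega
  obtain ⟨x, hx, y, hy, hxy⟩ := one_lt_card.1 hcard
  simp only [mem_filter, hTmem] at hx hy
  exact ⟨x, y, hxy, ⟨by omega, hinner x hx.1.1 hx.1.2, hx.2⟩,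
    ⟨by omega, hinner y hy.1.1 hy.1.2, hy.2⟩⟩

lemma exists_two_short [Fintype V] (hsurj : ∀ t < n, ∃ x, p x = t)
    (hinj : Function.Injective p) (hne : ∀ x, σ (σ x) ≠ x)
    (htr : ∀ S : V → Prop, (∀ x, S x → S (σ x)) → (∃ x, S x) → ∀ x, S x)
    (htr' : ∀ S : V → Prop, (∀ x, S x → S (σ⁻¹ x)) → (∃ x, S x) → ∀ x, S x)
    (hlt : ∀ x, p x < n)
    (huniq : ∀ x y z, Alt (p x) (p (σ x)) (p y) (p (σ y)) →
      Alt (p x) (p (σ x)) (p z) (p (σ z)) → y = z)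
    (hr2 : 2 ≤ r) (hrn : r + 2 ≤ n) (heven : Even (r + 1)) {a : V}
    (ha : (p a = 0 ∧ p (σ a) = r) ∨ (p a = r ∧ p (σ a) = 0)) :
    ∃ x y, x ≠ y ∧ (p x ≤ r ∧ p (σ x) ≤ r ∧ (p x + 1 = p (σ x) ∨ p (σ x) + 1 = p x)) ∧
      (p y ≤ r ∧ p (σ y) ≤ r ∧ (p y + 1 = p (σ y) ∨ p (σ y) + 1 = p y)) := by
  by_cases hinner : ∀ x, 0 < p x → p x < r → p (σ x) ≤ r
  · exact exists_two_short_of_inner hsurj hinj hne htr hlt huniq hr2 hrn heven ha hinner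
  push Not at hinner
  obtain ⟨x, hx0, hxr, hx⟩ := hinner
  have flip : ∀ {s t u w : ℕ}, Alt s t u w → Alt t s w u := by
    intro s t u w h
    unfold Alt at *
    omega
  have hne' : ∀ x, σ⁻¹ (σ⁻¹ x) ≠ x := fun x h => by
    rw [Equiv.Perm.inv_eq_iff_eq, Equiv.Perm.inv_eq_iff_eq] at h
    exact hne x h.symm
  have huniq' : ∀ x y z, Alt (p x) (p (σ⁻¹ x)) (p y) (p (σ⁻¹ y)) →
      Alt (p x) (p (σ⁻¹ x)) (p z) (p (σ⁻¹ z)) → y = z := fun x y z hy hz => by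
    apply σ⁻¹.injective
    apply huniq (σ⁻¹ x)
    · simpa using flip hy
    · simpa using flip hz
  have hinner' : ∀ y, 0 < p y → p y < r → p (σ⁻¹ y) ≤ r := by
    intro y hy0 hyr
    by_contra! hy
    have := huniq a x (σ⁻¹ y) (by unfold Alt; omega)
      (by simp only [Equiv.Perm.coe_inv, Equiv.apply_symm_apply] at hy ⊢; unfold Alt; omega)
    rw [← this] at hy
    omega
  obtain ⟨x, y, hxy, hx, hy⟩ := exists_two_short_of_inner (σ := σ⁻¹) hsurj hinj hne' htr' hlt
    huniq' hr2 hrn heven (a := σ a)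
    (by simp only [Equiv.Perm.coe_inv, Equiv.symm_apply_apply]; omega) hinner'
  refine ⟨σ⁻¹ x, σ⁻¹ y, fun h => hxy (σ⁻¹.injective h), ?_, ?_⟩ <;>
  · simp only [Equiv.Perm.coe_inv, Equiv.apply_symm_apply] at hx hy ⊢
    omega

end Combinatorics

/-- A nonempty set closed under a full cycle is everything. -/
lemma IsHamCycle.forall_of_closed {n : ℕ} {σ : Equiv.Perm (Fin n)} (hσ : IsHamCycle σ)
    (S : Fin n → Prop) (hS : ∀ x, S x → S (σ x)) (hx : ∃ x, S x) : ∀ x, S x := by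
  intro y
  obtain ⟨x, hx⟩ := hx
  have hmoved : ∀ z, σ z ≠ z := fun z => Equiv.Perm.mem_support.1 (by rw [hσ.2]; simp)
  obtain ⟨k, rfl⟩ := hσ.1.exists_pow_eq (hmoved x) (hmoved y)
  induction k with
  | zero => simpa using hx
  | succ k ih =>
    rw [pow_succ', Equiv.Perm.mul_apply]
    exact hS _ ih

lemma IsHamCycle.inv {n : ℕ} {σ : Equiv.Perm (Fin n)} (hσ : IsHamCycle σ) :
    IsHamCycle σ⁻¹ :=
  ⟨hσ.1.inv, by rw [Equiv.Perm.support_inv, hσ.2]⟩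

lemma IsHamCycle.apply_apply_ne {n : ℕ} {σ : Equiv.Perm (Fin n)} (hσ : IsHamCycle σ)
    (hn : 3 ≤ n) (x : Fin n) : σ (σ x) ≠ x := by
  intro h
  have hall := hσ.forall_of_closed (fun z => z = x ∨ z = σ x)
    (by rintro z (rfl | rfl) <;> simp [h]) ⟨x, Or.inl rfl⟩
  have hcard : (univ : Finset (Fin n)).card ≤ ({x, σ x} : Finset (Fin n)).card :=
    card_le_card fun z _ => by simpa using hall z
  have := hcard.trans card_le_two
  rw [card_univ, Fintype.card_fin] at this
  omega

/-- if a 1-plane Hamiltonian cycle on `n ≥ 3` points in convex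
position contains a diagonal edge `v_i v_j` and the part `{v_j, …, v_i}` of `P`
determined by it has an even number of points, then the cycle contains at least
two distinct boundary edges with both endpoints in that part. -/
theorem stmt1 {n : ℕ} [NeZero n] (hn : 3 ≤ n) (v : Fin n → Pt)
    (hconv : ConvexCcw v) (σ : Equiv.Perm (Fin n)) (hC : IsOnePlaneHC v σ)
    (i j : Fin n) (hij : i ≠ j) (hdiag₁ : j ≠ i + 1) (hdiag₂ : i ≠ j + 1)
    (hedge : s(i, j) ∈ cycEdges σ)
    (heven : Even ((i - j).val + 1)) :
    ∃ k l : Fin n, k ≠ l ∧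
      (InArc j i k ∧ InArc j i (k + 1) ∧ s(k, k + 1) ∈ cycEdges σ) ∧
      (InArc j i l ∧ InArc j i (l + 1) ∧ s(l, l + 1) ∈ cycEdges σ) := by
  obtain ⟨hham, hplane⟩ := hC
  have hne := hham.apply_apply_ne hn
  have edge_inj : ∀ {x y : Fin n}, s(x, σ x) = s(y, σ y) → x = y := by
    intro x y h
    rw [Sym2.eq_iff] at h
    rcases h with h | ⟨h1, h2⟩
    · exact h.1
    · exact absurd (by rw [← h1, h2]) (hne y)
  have step : ∀ {x y : Fin n}, (x - j).val + 1 = (y - j).val → y = x + 1 := by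
    intro x y h
    have : y - j = (x - j) + 1 := by
      apply Fin.ext
      rw [← h, Fin.val_add_one_of_lt' (by have := (y - j).isLt; omega)]
    rw [← sub_add_cancel y j, this, add_right_comm, sub_add_cancel]
  have hpj : (j - j).val = 0 := by rw [sub_self, Fin.val_zero]
  have hr0 : (i - j).val ≠ 0 := fun h => hij (sub_eq_zero.1 (Fin.ext (by simpa using h)))
  have hr1 : (i - j).val ≠ 1 := fun h => hdiag₂ (step (by rw [hpj, h]))
  have hrn : (i - j).val + 1 ≠ n := by
    intro h
    have h0 : i - j + 1 = 0 := by
      apply Fin.ext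
      rw [Fin.val_add, Fin.val_one', Nat.mod_eq_of_lt (by omega : 1 < n), h, Nat.mod_self,
        Fin.val_zero]
    rw [← add_sub_right_comm, sub_eq_zero] at h0
    exact hdiag₁ h0.symm
  have hrlt := (i - j).isLt
  obtain ⟨a, ha⟩ := hedge
  obtain ⟨x, y, hxy, hx, hy⟩ := exists_two_short (σ := σ) (p := fun x => (x - j).val)
    (r := (i - j).val) (a := a)
    (fun t ht => ⟨⟨t, ht⟩ + j, by simp⟩)
    (fun x y h => sub_left_injective (Fin.ext h)) hne hham.forall_of_closed
    hham.inv.forall_of_closed (fun x => (x - j).isLt)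
    (fun x y z hy hz => edge_inj (hplane s(x, σ x) ⟨x, rfl⟩
      ⟨⟨y, rfl⟩, hconv.edgesCross_of_alt j hy⟩ ⟨⟨z, rfl⟩, hconv.edgesCross_of_alt j hz⟩))
    (by omega) (by omega) heven (by
      rcases Sym2.eq_iff.1 ha with ⟨h1, h2⟩ | ⟨h1, h2⟩
      · exact Or.inr ⟨by rw [h1], by rw [← h2, hpj]⟩
      · exact Or.inl ⟨by rw [← h2, hpj], by rw [h1]⟩)
  have boundary : ∀ x, ((x - j).val ≤ (i - j).val ∧ (σ x - j).val ≤ (i - j).val ∧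
      ((x - j).val + 1 = (σ x - j).val ∨ (σ x - j).val + 1 = (x - j).val)) →
      ∃ k, (InArc j i k ∧ InArc j i (k + 1)) ∧ s(k, k + 1) = s(x, σ x) := by
    rintro x ⟨h1, h2, h | h⟩
    · exact ⟨x, ⟨h1, by rwa [← step h]⟩, by rw [← step h]⟩
    · exact ⟨σ x, ⟨h2, by rwa [← step h]⟩, by rw [← step h, Sym2.eq_swap]⟩
  obtain ⟨k, ⟨hk1, hk2⟩, hk⟩ := boundary x hx
  obtain ⟨l, ⟨hl1, hl2⟩, hl⟩ := boundary y hy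
  refine ⟨k, l, ?_, ⟨hk1, hk2, x, hk⟩, ⟨hl1, hl2, y, hl⟩⟩
  rintro rfl
  exact hxy (edge_inj (hk.symm.trans hl))

end
end

section
/- Let P = {v_0, v_1, …, v_{n−1}} be a set of n ≥ 4 points in convex position in the plane, and let C be a 1-plane Hamiltonian cycle on P that has exactly three boundary edges. Then C has at least one single boundary edge, and moreover there exists a single boundary edge v_r v_{r+1} of C such that both v_r v_{r+2} and v_{r+1} v_{r−1} are edges of C. -/
open Finset

noncomputable section

/-- `v_k v_{k+1}` is a single boundary edge of the edge set `E`: it is an edge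
and neither of the two neighbouring boundary edges is. -/
def SingleBoundary {n : ℕ} [NeZero n] (E : Set (Sym2 (Fin n))) (k : Fin n) : Prop :=
  s(k, k + 1) ∈ E ∧ s(k - 1, k) ∉ E ∧ s(k + 1, k + 1 + 1) ∉ E

/-- Adjacency in a 1-plane Hamiltonian cycle on `n` cyclically ordered points, with the points
indexed by `ℤ` modulo `n`. -/
structure ChordCycle (n : ℤ) (A : ℤ → ℤ → Prop) : Prop where
  symm : ∀ {a b}, A a b → A b a
  shift : ∀ {a b}, A a b → A a (b + n)
  unshift : ∀ {a b}, A a (b + n) → A a b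
  deg : ∀ {a b c d}, A a b → A a c → A a d → b < c → c < d → d < b + n → False
  plane : ∀ {p q r s r' s'}, A p q → A r s → A r' s' → p < r → r < q → q < s → s < p + n →
    p < r' → r' < q → q < s' → s' < p + n → r = r' ∧ s = s'
  arc : ∀ {p q u u'}, p + 2 ≤ q → q < p + n →
    (∀ w z, p < w → w < q → q < z → z < p + n → ¬ A w z) →
    A p u → q ≤ u → u < p + n → A q u' → q < u' → u' ≤ p + n →
    (∃ w, p < w ∧ w < q ∧ A p w) ∧ ∃ w, p < w ∧ w < q ∧ A q w
  two : ∀ i, ∃ y z, i < y ∧ y < z ∧ z < i + n ∧ A i y ∧ A i z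

namespace ChordCycle

variable {n : ℤ} {A : ℤ → ℤ → Prop}

/-- A diagonal is crossed by some edge. -/
theorem exists_cross (h : ChordCycle n A) {x y : ℤ} (hxy : A x y) (h₁ : x + 2 ≤ y)
    (h₂ : y ≤ x + n - 2) : ∃ r s, x < r ∧ r < y ∧ y < s ∧ s < x + n ∧ A r s := by
  by_contra! hno
  have hyx := h.shift (h.symm hxy)
  obtain ⟨⟨w, hw₁, hw₂, hw⟩, -⟩ := h.arc h₁ (by omega)
    (fun w z a b c d e => hno w z a b c d e) hxy le_rfl (by omega) hyx (by omega) le_rfl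
  obtain ⟨-, z, hz₁, hz₂, hz⟩ := h.arc (p := y) (q := x + n) (by omega) (by omega)
    (fun w z a b c d e => hno (z - n) w (by omega) (by omega) (by omega) (by omega)
      (h.symm (h.unshift (by simpa using e)))) hyx le_rfl (by omega)
    (h.shift (h.symm (h.shift (h.symm hxy)))) (by omega) le_rfl
  exact h.deg hw hxy (h.symm (h.unshift (h.symm hz))) hw₂ hz₁ (by omega)

/-- A diagonal and the edge crossing it join two pairs of consecutive points. -/
theorem neighbor_diagonal (h : ChordCycle n A) {x y : ℤ} (hxy : A x y) (h₁ : x + 2 ≤ y)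
    (h₂ : y ≤ x + n - 2) : A (x + 1) (y + 1) ∨ A (x - 1) (y - 1) := by
  obtain ⟨r, s, hr₁, hr₂, hs₁, hs₂, hrs⟩ := h.exists_cross hxy h₁ h₂
  have hyx : A y x := h.symm hxy
  have hyx' : A y (x + n) := h.shift hyx
  have hx'y : A (x + n) y := h.symm hyx'
  have hsr : A s r := h.symm hrs
  have hsr' : A s (r + n) := h.shift hsr
  have cx : ∀ {w z}, A w z → x < w → w < y → y < z → z < x + n → w = r ∧ z = s :=
    fun e a b c d => h.plane hxy e hrs a b c d hr₁ hr₂ hs₁ hs₂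
  have cr : ∀ {w z}, A w z → r < w → w < s → s < z → z < r + n → w = y ∧ z = x + n :=
    fun e a b c d => h.plane hrs e hyx' a b c d hr₂ hs₁ hs₂ (by omega)
  have arcα (e : x + 2 ≤ r) := h.arc (p := x) (q := r) e (by omega)
    (fun w z a b c d e => by
      by_cases h₃ : z < s
      · have := cr (h.shift (h.symm e)) (by omega) (by omega) (by omega) (by omega); omega
      · have := cx e (by omega) (by omega) (by omega) (by omega); omega)
    hxy (by omega) (by omega) hrs (by omega) (by omega)
  have arcβ (e : r + 2 ≤ y) := h.arc (p := r) (q := y) e (by omega)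
    (fun w z a b c d e => by
      by_cases h₃ : z ≤ s
      · by_cases h₄ : z = x + n
        · omega
        · have := cx e (by omega) (by omega) (by omega) (by omega); omega
      · have := cr e (by omega) (by omega) (by omega) (by omega); omega)
    hrs (by omega) (by omega) hyx' (by omega) (by omega)
  have arcγ (e : y + 2 ≤ s) := h.arc (p := y) (q := s) e (by omega)
    (fun w z a b c d e => by
      by_cases h₃ : z < r + n
      · have := cr e (by omega) (by omega) (by omega) (by omega); omega
      · have := cx (h.symm (h.unshift (b := z - n) (by simpa using e)))
          (by omega) (by omega) (by omega) (by omega)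
        omega)
    hyx' (by omega) (by omega) hsr' (by omega) (by omega)
  have arcδ (e : s + 2 ≤ x + n) := h.arc (p := s) (q := x + n) e (by omega)
    (fun w z a b c d e => by
      have e' := h.symm (h.unshift (b := z - n) (by simpa using e))
      by_cases h₃ : z - n < y
      · have := cx e' (by omega) (by omega) (by omega) (by omega); omega
      · have := cr e' (by omega) (by omega) (by omega) (by omega); omega)
    hsr' (by omega) (by omega) (h.shift hx'y) (by omega) (by omega)
  have nαβ : ¬ (x + 2 ≤ r ∧ r + 2 ≤ y) := fun ⟨e, f⟩ => by
    obtain ⟨-, w, _, _, hw⟩ := arcα e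
    obtain ⟨⟨z, _, _, hz⟩, -⟩ := arcβ f
    exact h.deg hw hz hrs (by omega) (by omega) (by omega)
  have nβγ : ¬ (r + 2 ≤ y ∧ y + 2 ≤ s) := fun ⟨e, f⟩ => by
    obtain ⟨-, w, _, _, hw⟩ := arcβ e
    obtain ⟨⟨z, _, _, hz⟩, -⟩ := arcγ f
    exact h.deg hw hz hyx' (by omega) (by omega) (by omega)
  have nγδ : ¬ (y + 2 ≤ s ∧ s + 2 ≤ x + n) := fun ⟨e, f⟩ => by
    obtain ⟨-, w, _, _, hw⟩ := arcγ e
    obtain ⟨⟨z, _, _, hz⟩, -⟩ := arcδ f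
    exact h.deg hw hz hsr' (by omega) (by omega) (by omega)
  have nδα : ¬ (s + 2 ≤ x + n ∧ x + 2 ≤ r) := fun ⟨e, f⟩ => by
    obtain ⟨-, w, _, _, hw⟩ := arcδ e
    obtain ⟨⟨z, _, _, hz⟩, -⟩ := arcα f
    exact h.deg hz hxy (h.symm (h.unshift (h.symm hw))) (by omega) (by omega) (by omega)
  have : (r = x + 1 ∧ s = y + 1) ∨ (r = y - 1 ∧ s = x - 1 + n) := by omega
  rcases this with ⟨rfl, rfl⟩ | ⟨rfl, rfl⟩
  · exact Or.inl hrs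
  · exact Or.inr (h.symm (h.unshift hrs))

/-- In the arc `[i, j]` cut off by a crossing pair there is a boundary edge cut off by a crossing
pair, or there are two boundary edges. -/
theorem crossed_boundary_or_two (h : ChordCycle n A) (hn : 5 ≤ n) (m : ℕ) :
    ∀ i j : ℤ, j - i ≤ m → i < j → j ≤ i + n - 3 → A (i - 1) j → A i (j + 1) →
      (∃ r, A r (r + 1) ∧ A r (r + 2) ∧ A (r + 1) (r - 1)) ∨
      ∃ k₁ k₂, i ≤ k₁ ∧ k₁ < k₂ ∧ k₂ < j ∧ A k₁ (k₁ + 1) ∧ A k₂ (k₂ + 1) := by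
  induction m with
  | zero => intro i j _ _; omega
  | succ m ih =>
    intro i j hm hij hjn h₁ h₂
    push_cast at hm
    have c₁ : ∀ {w z}, A w z → i - 1 < w → w < j → j < z → z < i - 1 + n → w = i ∧ z = j + 1 :=
      fun e a b c d => h.plane h₁ e h₂ a b c d (by omega) (by omega) (by omega) (by omega)
    have h₁' : A j (i - 1 + n) := h.shift (h.symm h₁)
    have c₂ : ∀ {w z}, A w z → i < w → w < j + 1 → j + 1 < z → z < i + n →
        w = j ∧ z = i - 1 + n :=
      fun e a b c d => h.plane h₂ e h₁' a b c d (by omega) (by omega) (by omega) (by omega)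
    by_cases hd : ∃ p q, i ≤ p ∧ p + 2 ≤ q ∧ q ≤ j ∧ A p q
    · obtain ⟨p, q, hp, hpq, hq, e⟩ := hd
      rcases h.neighbor_diagonal e hpq (by omega) with f | f
      · rcases ih (p + 1) q (by omega) (by omega) (by omega) (by simpa using e) f with g | g
        · exact Or.inl g
        · obtain ⟨k₁, k₂, _, _, _, g₁, g₂⟩ := g
          exact Or.inr ⟨k₁, k₂, by omega, by omega, by omega, g₁, g₂⟩
      · rcases ih p (q - 1) (by omega) (by omega) (by omega) f (by simpa using e) with g | g
        · exact Or.inl g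
        · obtain ⟨k₁, k₂, _, _, _, g₁, g₂⟩ := g
          exact Or.inr ⟨k₁, k₂, by omega, by omega, by omega, g₁, g₂⟩
    · push Not at hd
      by_cases hj : i + 2 ≤ j
      · right
        obtain ⟨⟨w, hw₁, hw₂, hw⟩, z, hz₁, hz₂, hz⟩ := h.arc (p := i) (q := j) hj (by omega)
          (fun w z a b c d e => by
            by_cases hz : z = i - 1 + n
            · have := c₂ e (by omega) (by omega) (by omega) (by omega); omega
            · have := c₁ e (by omega) (by omega) (by omega) (by omega); omega)
          h₂ (by omega) (by omega) h₁' (by omega) (by omega)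
        have hwi : w = i + 1 := by
          by_contra
          exact hd i w le_rfl (by omega) (by omega) hw
        have hzj : z = j - 1 := by
          by_contra
          exact hd z j (by omega) (by omega) le_rfl (h.symm hz)
        subst hwi hzj
        exact ⟨i, j - 1, le_rfl, by omega, by omega, hw, by simpa using h.symm hz⟩
      · left
        obtain rfl : j = i + 1 := by omega
        obtain ⟨-, w, hw₁, hw₂, hw⟩ := h.arc (p := i + 1 + 1) (q := i - 1 + n) (by omega) (by omega)
          (fun w z a b c d e => by
            have e' := h.symm (h.unshift (b := z - n) (by simpa using e))
            by_cases hz : z - n = i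
            · have := c₁ e' (by omega) (by omega) (by omega) (by omega)
              omega
            · have := c₂ e' (by omega) (by omega) (by omega) (by omega)
              omega)
          (h.shift (h.symm h₂)) (by omega) (by omega)
          (h.shift (h.symm h₁')) (by omega) (by omega)
        have key : A i (i + 1) := by
          obtain ⟨y, z, hy, hyz, hz, ey, ez⟩ := h.two i
          by_contra hno
          have hy' : y ≠ i + 1 := by rintro rfl; exact hno ey
          have hz' : z = i - 1 + n := by
            by_contra
            have := c₁ ez (by omega) (by omega) (by omega) (by omega)
            omega
          subst hz'
          exact h.deg (h.symm ez) (h.symm h₁') hw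
            (by omega) (by omega) (by omega)
        refine ⟨i, key, ?_, h.symm h₁⟩
        rwa [show i + 2 = i + 1 + 1 by ring]

/-- With exactly three boundary edges, one of them is cut off by a crossing pair of edges. -/
theorem exists_crossed_boundary (h : ChordCycle n A) (hn : 4 ≤ n) (nonbd : ∃ k, ¬ A k (k + 1))
    (few : ∀ k₁ k₂ k₃ k₄, A k₁ (k₁ + 1) → A k₂ (k₂ + 1) → A k₃ (k₃ + 1) → A k₄ (k₄ + 1) →
      k₁ < k₂ → k₂ < k₃ → k₃ < k₄ → k₄ < k₁ + n → False)
    (many : ∀ x, ∃ k₁ k₂ k₃, x ≤ k₁ ∧ k₁ < k₂ ∧ k₂ < k₃ ∧ k₃ < x + n ∧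
      A k₁ (k₁ + 1) ∧ A k₂ (k₂ + 1) ∧ A k₃ (k₃ + 1)) :
    ∃ r, A r (r + 1) ∧ A r (r + 2) ∧ A (r + 1) (r - 1) := by
  have hdiag : ∃ x y, A x y ∧ x + 2 ≤ y ∧ y ≤ x + n - 2 := by
    obtain ⟨k, hk⟩ := nonbd
    obtain ⟨y, z, hy, hyz, hz, ey, ez⟩ := h.two k
    have hy' : y ≠ k + 1 := by rintro rfl; exact hk ey
    exact ⟨k, y, ey, by omega, by omega⟩
  have hpair : ∃ x y, A x y ∧ x + 2 ≤ y ∧ y ≤ x + n - 2 ∧ A (x + 1) (y + 1) := by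
    obtain ⟨x, y, e, h₁, h₂⟩ := hdiag
    rcases h.neighbor_diagonal e h₁ h₂ with f | f
    · exact ⟨x, y, e, h₁, h₂, f⟩
    · exact ⟨x - 1, y - 1, f, by omega, by omega, by simpa using e⟩
  obtain ⟨x, y, e, h₁, h₂, f⟩ := hpair
  have e' : A y (x + n) := h.shift (h.symm e)
  have f' : A (y + 1) (x + n + 1) := by
    have := h.shift (h.symm f)
    rwa [show x + n + 1 = x + 1 + n by ring]
  rcases hn.eq_or_lt with rfl | hn
  · exfalso
    obtain rfl : y = x + 2 := by omega
    have b₁ : ¬ (A (x - 1) (x - 1 + 1) ∧ A x (x + 1)) := fun ⟨p, q⟩ => by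
      rw [sub_add_cancel] at p
      exact h.deg q e (h.shift (h.symm p)) (by omega) (by omega) (by omega)
    have b₂ : ¬ (A (x + 1) (x + 1 + 1) ∧ A (x + 2) (x + 2 + 1)) := fun ⟨p, q⟩ => by
      rw [show x + 1 + 1 = x + 2 by ring] at p
      exact h.deg (h.symm e) (h.symm p) q (by omega) (by omega) (by omega)
    obtain ⟨k₁, k₂, k₃, _, _, _, _, g₁, g₂, g₃⟩ := many (x - 1)
    have hk : (k₁ = x - 1 ∧ k₂ = x) ∨ (k₂ = x + 1 ∧ k₃ = x + 2) := by omega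
    rcases hk with ⟨rfl, rfl⟩ | ⟨rfl, rfl⟩
    · exact b₁ ⟨g₁, g₂⟩
    · exact b₂ ⟨g₂, g₃⟩
  · rcases h.crossed_boundary_or_two hn _ (x + 1) y (Int.self_le_toNat _) (by omega) (by omega)
      (by simpa using e) f with g | ⟨k₁, k₂, _, _, _, g₁, g₂⟩
    · exact g
    rcases h.crossed_boundary_or_two hn _ (y + 1) (x + n) (Int.self_le_toNat _) (by omega)
      (by omega) (by simpa using e') f' with g | ⟨k₃, k₄, _, _, _, g₃, g₄⟩
    · exact g
    exact (few k₁ k₂ k₃ k₄ g₁ g₂ g₃ g₄ (by omega) (by omega) (by omega) (by omega)).elim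

end ChordCycle

/-- The vertex index of an integer modulo `n`. -/
def idx (n : ℕ) [NeZero n] (a : ℤ) : Fin n :=
  ⟨(a % n).toNat, by
    have hn : (0 : ℤ) < n := by exact_mod_cast NeZero.pos n
    have := Int.emod_lt_of_pos a hn
    have := Int.emod_nonneg a hn.ne'
    omega⟩

/-- Adjacency in the cycle `σ`, for integer indices. -/
def Adj {n : ℕ} [NeZero n] (σ : Equiv.Perm (Fin n)) (a b : ℤ) : Prop :=
  s(idx n a, idx n b) ∈ cycEdges σ

section idx

variable {n : ℕ} [NeZero n]

theorem coe_idx (a : ℤ) : ((idx n a).val : ℤ) = a % n :=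
  Int.toNat_of_nonneg (Int.emod_nonneg a (by exact_mod_cast NeZero.ne n))

theorem idx_eq_iff {a b : ℤ} : idx n a = idx n b ↔ a % n = b % n := by
  rw [← coe_idx, ← coe_idx, Fin.ext_iff, Nat.cast_inj]

theorem idx_add (a : ℤ) : idx n (a + n) = idx n a := by
  simp [idx_eq_iff]

theorem eq_of_idx_eq {a b : ℤ} (h : idx n a = idx n b) : a < b + n → b < a + n → a = b := by
  intro h₁ h₂
  have hd : (n : ℤ) ∣ b - a := Int.ModEq.dvd (idx_eq_iff.1 h)
  have := Int.eq_zero_of_abs_lt_dvd hd (abs_lt.2 ⟨by omega, by omega⟩)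
  omega

theorem exists_idx_eq (k : Fin n) (x : ℤ) : ∃ z, x ≤ z ∧ z < x + n ∧ idx n z = k := by
  have hn : (0 : ℤ) < n := by exact_mod_cast NeZero.pos n
  have h₀ := Int.emod_nonneg (k.val - x) hn.ne'
  have h₁ := Int.emod_lt_of_pos (k.val - x) hn
  refine ⟨x + (k.val - x) % n, by linarith, by linarith, ?_⟩
  apply Fin.ext
  zify
  rw [coe_idx, Int.add_emod, Int.emod_emod, ← Int.add_emod, add_sub_cancel,
    Int.emod_eq_of_lt (by omega) (by omega)]

theorem idx_add_one (hn : 4 ≤ n) (a : ℤ) : idx n (a + 1) = idx n a + 1 := by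
  apply Fin.ext
  zify
  rw [coe_idx, Fin.val_add, Int.natCast_mod, Nat.cast_add, coe_idx, Fin.val_one',
    Nat.mod_eq_of_lt (by omega)]
  simp

end idx

theorem edgesCross_of_lt {n : ℕ} {v : Fin n → Pt} (hv : ConvexCcw v) {i j k l : Fin n}
    (hij : i < j) (hjk : j < k) (hkl : k < l) : EdgesCross v s(i, k) s(j, l) := by
  have h₁ := hv i j k hij hjk
  have h₂ := hv i j l hij (hjk.trans hkl)
  have h₃ := hv i k l (hij.trans hjk) hkl
  have h₄ := hv j k l hjk hkl
  constructor
  · intro a ha hb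
    rw [Sym2.mem_iff] at ha hb
    rcases ha with rfl | rfl <;> rcases hb with rfl | rfl <;> order
  · simp only [seg, Sym2.lift_mk]
    unfold Ccw at h₁ h₂ h₃ h₄
    set ijk := (v j 0 - v i 0) * (v k 1 - v i 1) - (v j 1 - v i 1) * (v k 0 - v i 0) with e₁
    set ijl := (v j 0 - v i 0) * (v l 1 - v i 1) - (v j 1 - v i 1) * (v l 0 - v i 0) with e₂
    set ikl := (v k 0 - v i 0) * (v l 1 - v i 1) - (v k 1 - v i 1) * (v l 0 - v i 0) with e₃
    set jkl := (v k 0 - v j 0) * (v l 1 - v j 1) - (v k 1 - v j 1) * (v l 0 - v j 0) with e₄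
    have hT : ijl + jkl = ijk + ikl := by rw [e₁, e₂, e₃, e₄]; ring
    have hT₀ : 0 < ijl + jkl := add_pos h₂ h₄
    refine ⟨(jkl / (ijl + jkl)) • v i + (ijl / (ijl + jkl)) • v k,
      ⟨_, _, div_pos h₄ hT₀, div_pos h₂ hT₀, by field_simp; ring, rfl⟩,
      ⟨ikl / (ijl + jkl), ijk / (ijl + jkl), div_pos h₃ hT₀, div_pos h₁ hT₀, ?_, ?_⟩⟩
    · rw [← add_div, add_comm ikl, ← hT, div_self hT₀.ne']
    · ext t
      simp only [PiLp.add_apply, PiLp.smul_apply, smul_eq_mul]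
      rw [div_mul_eq_mul_div, div_mul_eq_mul_div, div_mul_eq_mul_div, div_mul_eq_mul_div,
        ← add_div, ← add_div]
      congr 1
      rw [e₁, e₂, e₃, e₄]
      fin_cases t <;> simp <;> ring

theorem EdgesCross.symm {n : ℕ} {v : Fin n → Pt} {e f : Sym2 (Fin n)} (h : EdgesCross v e f) :
    EdgesCross v f e :=
  ⟨fun a ha hb => h.1 a hb ha, by rw [Set.inter_comm]; exact h.2⟩

theorem idx_lt_idx {n : ℕ} [NeZero n] {a b : ℤ} (ha : 0 ≤ a) (hab : a < b) (hb : b < n) :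
    idx n a < idx n b := by
  rw [Fin.lt_def, ← Nat.cast_lt (α := ℤ), coe_idx, coe_idx, Int.emod_eq_of_lt ha (by omega),
    Int.emod_eq_of_lt (by omega) hb]
  exact hab

theorem edgesCross_idx {n : ℕ} [NeZero n] {v : Fin n → Pt} (hv : ConvexCcw v) {p q r s : ℤ}
    (hpr : p < r) (hrq : r < q) (hqs : q < s) (hsp : s < p + n) :
    EdgesCross v s(idx n p, idx n q) s(idx n r, idx n s) := by
  have hn : (0 : ℤ) < n := by exact_mod_cast NeZero.pos n
  have red (a : ℤ) : idx n a = idx n (a - n * (p / n)) := by simp [idx_eq_iff]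
  have red' (a : ℤ) : idx n a = idx n (a - n) := by simp [idx_eq_iff]
  rw [red p, red q, red r, red s]
  have h₀ := Int.emod_nonneg p hn.ne'
  have h₁ := Int.emod_lt_of_pos p hn
  rw [Int.emod_def] at h₀ h₁
  generalize n * (p / n) = d at *
  rcases lt_or_ge (s - d) n with hs | hs
  · exact edgesCross_of_lt hv (idx_lt_idx h₀ (by omega) (by omega))
      (idx_lt_idx (by omega) (by omega) (by omega)) (idx_lt_idx (by omega) (by omega) (by omega))
  rw [red' (s - d)]
  rcases lt_or_ge (q - d) n with hq | hq
  · rw [Sym2.eq_swap (a := idx n (r - d))]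
    exact (edgesCross_of_lt hv (idx_lt_idx (by omega) (by omega) (by omega))
      (idx_lt_idx (by omega) (by omega) (by omega))
      (idx_lt_idx (by omega) (by omega) (by omega))).symm
  rw [red' (q - d)]
  rcases lt_or_ge (r - d) n with hr | hr
  · rw [Sym2.eq_swap (a := idx n (r - d)), Sym2.eq_swap (a := idx n (p - d))]
    exact edgesCross_of_lt hv (idx_lt_idx (by omega) (by omega) (by omega))
      (idx_lt_idx (by omega) (by omega) (by omega)) (idx_lt_idx (by omega) (by omega) (by omega))
  · rw [red' (r - d), Sym2.eq_swap (a := idx n (p - d))]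
    exact (edgesCross_of_lt hv (idx_lt_idx (by omega) (by omega) (by omega))
      (idx_lt_idx (by omega) (by omega) (by omega))
      (idx_lt_idx (by omega) (by omega) (by omega))).symm

theorem mem_cycEdges {n : ℕ} {σ : Equiv.Perm (Fin n)} {i j : Fin n} :
    s(i, j) ∈ cycEdges σ ↔ σ i = j ∨ σ j = i := by
  simp only [cycEdges, Set.mem_ofPred_eq, Sym2.eq_iff]
  constructor
  · rintro ⟨k, ⟨rfl, rfl⟩ | ⟨rfl, rfl⟩⟩ <;> simp
  · rintro (rfl | rfl)
    · exact ⟨i, by simp⟩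
    · exact ⟨j, by simp⟩

/-- A proper nonempty set of vertices is left by some arc of a Hamiltonian cycle. -/
theorem IsHamCycle.exists_exit {n : ℕ} {σ : Equiv.Perm (Fin n)} (h : IsHamCycle σ)
    (W : Set (Fin n)) {i j : Fin n} (hi : i ∈ W) (hj : j ∉ W) : ∃ k ∈ W, σ k ∉ W := by
  by_contra! hW
  have hne (k : Fin n) : σ k ≠ k := Equiv.Perm.mem_support.1 (h.2 ▸ Finset.mem_univ k)
  obtain ⟨m, rfl⟩ := h.1.exists_pow_eq (hne i) (hne j)
  have (m : ℕ) : (σ ^ m) i ∈ W := by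
    induction m with
    | zero => simpa
    | succ m ih => rw [pow_succ', Equiv.Perm.mul_apply]; exact hW _ ih
  exact hj (this m)

theorem chordCycle_adj {n : ℕ} [NeZero n] (hn : 4 ≤ n) {v : Fin n → Pt} (hv : ConvexCcw v)
    {σ : Equiv.Perm (Fin n)} (hC : IsOnePlaneHC v σ) : ChordCycle n (Adj σ) where
  symm {a b} h := by rwa [Adj, Sym2.eq_swap]
  shift {a b} h := by rwa [Adj, idx_add]
  unshift {a b} h := by rwa [Adj, idx_add] at h
  deg {a b c d} hb hc hd hbc hcd hdb := by
    simp only [Adj, mem_cycEdges] at hb hc hd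
    have e₁ : idx n b ≠ idx n c := fun e => by have := eq_of_idx_eq e; omega
    have e₂ : idx n b ≠ idx n d := fun e => by have := eq_of_idx_eq e; omega
    have e₃ : idx n c ≠ idx n d := fun e => by have := eq_of_idx_eq e; omega
    have inj {i j : Fin n} (hi : σ i = idx n a) (hj : σ j = idx n a) : i = j :=
      σ.injective (hi.trans hj.symm)
    grind
  plane {p q r s r' s'} hpq hrs hrs' h₁ h₂ h₃ h₄ h₁' h₂' h₃' h₄' := by
    have := hC.2 _ hpq ⟨hrs, edgesCross_idx hv h₁ h₂ h₃ h₄⟩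
      ⟨hrs', edgesCross_idx hv h₁' h₂' h₃' h₄'⟩
    rcases Sym2.eq_iff.1 this with ⟨e, f⟩ | ⟨e, f⟩
    · exact ⟨eq_of_idx_eq e (by omega) (by omega), eq_of_idx_eq f (by omega) (by omega)⟩
    · have := eq_of_idx_eq e
      omega
  arc {p q u u'} hpq hqn hno hu hu₁ hu₂ hu' hu₁' hu₂' := by
    let W : Set (Fin n) := {k | ∃ w, p < w ∧ w < q ∧ idx n w = k}
    have hp1 : idx n (p + 1) ∈ W := ⟨p + 1, by omega, by omega, rfl⟩
    have hp : idx n p ∉ W := fun ⟨w, h₁, h₂, e⟩ => by have := eq_of_idx_eq e; omega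
    obtain ⟨_, ⟨w, hw₁, hw₂, rfl⟩, hw⟩ := hC.1.exists_exit W hp1 hp
    obtain ⟨k, hk, hk'⟩ := hC.1.exists_exit Wᶜ hp (by simpa using hp1)
    obtain ⟨w', hw₁', hw₂', hw'⟩ := not_not.1 hk'
    have ends {k : Fin n} (hk : k ∉ W) {w : ℤ} (h₁ : p < w) (h₂ : w < q)
        (h : σ k = idx n w ∨ σ (idx n w) = k) : k = idx n p ∨ k = idx n q := by
      obtain ⟨z, hz₁, hz₂, rfl⟩ := exists_idx_eq k p
      rcases hz₁.eq_or_lt with rfl | hz₁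
      · exact Or.inl rfl
      have hzq : ¬ z < q := fun hzq => hk ⟨z, hz₁, hzq, rfl⟩
      rcases eq_or_ne z q with rfl | hzq'
      · exact Or.inr rfl
      · exact (hno w z h₁ h₂ (by omega) hz₂ (mem_cycEdges.2 h.symm)).elim
    have h₁ := ends hw hw₁ hw₂ (Or.inr rfl)
    have h₂ := ends hk hw₁' hw₂' (Or.inl hw'.symm)
    have hpu {w : ℤ} (h₁ : p < w) (h₂ : w < q) : idx n u ≠ idx n w :=
      fun e => by have := eq_of_idx_eq e; omega
    have hqu {w : ℤ} (h₁ : p < w) (h₂ : w < q) : idx n u' ≠ idx n w :=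
      fun e => by have := eq_of_idx_eq e; omega
    simp only [Adj, mem_cycEdges] at hu hu' ⊢
    rcases h₁ with h₁ | h₁ <;> rcases h₂ with rfl | rfl
    · exfalso
      rcases hu with hu | hu
      · exact hpu hw₁' hw₂' (hu.symm.trans hw'.symm)
      · exact hpu hw₁ hw₂ (σ.injective (hu.trans h₁.symm))
    · exact ⟨⟨w, hw₁, hw₂, Or.inr h₁⟩, w', hw₁', hw₂', Or.inl hw'.symm⟩
    · exact ⟨⟨w', hw₁', hw₂', Or.inl hw'.symm⟩, w, hw₁, hw₂, Or.inr h₁⟩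
    · exfalso
      rcases hu' with hu' | hu'
      · exact hqu hw₁' hw₂' (hu'.symm.trans hw'.symm)
      · exact hqu hw₁ hw₂ (σ.injective (hu'.trans h₁.symm))
  two i := by
    have hne (k : Fin n) : σ k ≠ k := Equiv.Perm.mem_support.1 (hC.1.2 ▸ Finset.mem_univ k)
    obtain ⟨y, hy₁, hy₂, hy⟩ := exists_idx_eq (σ (idx n i)) i
    obtain ⟨z, hz₁, hz₂, hz⟩ := exists_idx_eq (σ.symm (idx n i)) i
    have hyi : y ≠ i := by rintro rfl; exact hne _ hy.symm
    have hzi : z ≠ i := by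
      rintro rfl
      exact hne (idx n z) (by conv_lhs => rw [hz, Equiv.apply_symm_apply])
    have hyz : y ≠ z := by
      rintro rfl
      obtain ⟨t, ht, ht'⟩ : ∃ t : Fin n, t ≠ idx n i ∧ t ≠ idx n y := by
        by_contra! hall
        have hcard : (Finset.univ : Finset (Fin n)) ⊆ {idx n i, idx n y} := fun t _ => by
          by_cases ht : t = idx n i
          · simp [ht]
          · simp [hall t ht]
        have := (Finset.card_le_card hcard).trans Finset.card_le_two
        rw [Finset.card_univ, Fintype.card_fin] at this
        omega
      obtain ⟨k, hk, hk'⟩ := hC.1.exists_exit {idx n i, idx n y} (Or.inl rfl)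
        (by simp [ht, ht'] : t ∉ _)
      rcases hk with rfl | rfl
      · exact hk' (Or.inr hy.symm)
      · exact hk' (Or.inl (by rw [hz, Equiv.apply_symm_apply]))
    have Ay : Adj σ i y := mem_cycEdges.2 (Or.inl hy.symm)
    have Az : Adj σ i z := mem_cycEdges.2 (Or.inr (by rw [hz, Equiv.apply_symm_apply]))
    rcases lt_or_gt_of_ne hyz with h | h
    · exact ⟨y, z, by omega, h, hz₂, Ay, Az⟩
    · exact ⟨z, y, by omega, h, hy₂, Az, Ay⟩

/-- a 1-plane Hamiltonian cycle on `n ≥ 4` points in convex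
position having exactly three boundary edges has at least one single boundary
edge, and moreover some single boundary edge `v_r v_{r+1}` of it is such that
both `v_r v_{r+2}` and `v_{r+1} v_{r-1}` are edges of the cycle. -/
theorem stmt5 {n : ℕ} [NeZero n] (hn : 4 ≤ n) (v : Fin n → Pt)
    (hconv : ConvexCcw v) (σ : Equiv.Perm (Fin n)) (hC : IsOnePlaneHC v σ)
    (a b c : Fin n) (hab : a ≠ b) (hac : a ≠ c) (hbc : b ≠ c)
    (hbd : ∀ k : Fin n, s(k, k + 1) ∈ cycEdges σ ↔ k = a ∨ k = b ∨ k = c) :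
    (∃ r : Fin n, SingleBoundary (cycEdges σ) r) ∧
    (∃ r : Fin n, SingleBoundary (cycEdges σ) r ∧
      s(r, r + 1 + 1) ∈ cycEdges σ ∧ s(r + 1, r - 1) ∈ cycEdges σ) := by
  have hn' : (4 : ℤ) ≤ n := by exact_mod_cast hn
  have h := chordCycle_adj hn hconv hC
  have step (k : ℤ) : s(idx n k, idx n k + 1) = s(idx n k, idx n (k + 1)) := by rw [idx_add_one hn]
  have bd (k : ℤ) : Adj σ k (k + 1) ↔ idx n k = a ∨ idx n k = b ∨ idx n k = c := by
    rw [← hbd, step]; rfl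
  have few (k₁ k₂ k₃ k₄ : ℤ) (h₁ : Adj σ k₁ (k₁ + 1)) (h₂ : Adj σ k₂ (k₂ + 1))
      (h₃ : Adj σ k₃ (k₃ + 1)) (h₄ : Adj σ k₄ (k₄ + 1)) (h₁₂ : k₁ < k₂) (h₂₃ : k₂ < k₃)
      (h₃₄ : k₃ < k₄) (h₄₁ : k₄ < k₁ + n) : False := by
    rw [bd] at h₁ h₂ h₃ h₄
    have e₁₂ : idx n k₁ ≠ idx n k₂ := fun e => by have := eq_of_idx_eq e; omega
    have e₁₃ : idx n k₁ ≠ idx n k₃ := fun e => by have := eq_of_idx_eq e; omega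
    have e₁₄ : idx n k₁ ≠ idx n k₄ := fun e => by have := eq_of_idx_eq e; omega
    have e₂₃ : idx n k₂ ≠ idx n k₃ := fun e => by have := eq_of_idx_eq e; omega
    have e₂₄ : idx n k₂ ≠ idx n k₄ := fun e => by have := eq_of_idx_eq e; omega
    have e₃₄ : idx n k₃ ≠ idx n k₄ := fun e => by have := eq_of_idx_eq e; omega
    grind
  have nonbd : ∃ k : ℤ, ¬ Adj σ k (k + 1) := by
    by_contra! hall
    exact few 0 1 2 3 (hall 0) (hall 1) (hall 2) (hall 3) (by omega) (by omega) (by omega)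
      (by omega)
  have many (x : ℤ) : ∃ k₁ k₂ k₃ : ℤ, x ≤ k₁ ∧ k₁ < k₂ ∧ k₂ < k₃ ∧ k₃ < x + n ∧
      Adj σ k₁ (k₁ + 1) ∧ Adj σ k₂ (k₂ + 1) ∧ Adj σ k₃ (k₃ + 1) := by
    obtain ⟨a', ha₁, ha₂, ha⟩ := exists_idx_eq a x
    obtain ⟨b', hb₁, hb₂, hb⟩ := exists_idx_eq b x
    obtain ⟨c', hc₁, hc₂, hc⟩ := exists_idx_eq c x
    have Ba := (bd a').2 (by simp [ha])
    have Bb := (bd b').2 (by simp [hb])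
    have Bc := (bd c').2 (by simp [hc])
    have nab : a' ≠ b' := by rintro rfl; exact hab (ha.symm.trans hb)
    have nac : a' ≠ c' := by rintro rfl; exact hac (ha.symm.trans hc)
    have nbc : b' ≠ c' := by rintro rfl; exact hbc (hb.symm.trans hc)
    rcases lt_or_gt_of_ne nab with h1 | h1 <;> rcases lt_or_gt_of_ne nac with h2 | h2 <;>
      rcases lt_or_gt_of_ne nbc with h3 | h3
    · exact ⟨a', b', c', by omega, by omega, by omega, by omega, Ba, Bb, Bc⟩
    · exact ⟨a', c', b', by omega, by omega, by omega, by omega, Ba, Bc, Bb⟩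
    · omega
    · exact ⟨c', a', b', by omega, by omega, by omega, by omega, Bc, Ba, Bb⟩
    · exact ⟨b', a', c', by omega, by omega, by omega, by omega, Bb, Ba, Bc⟩
    · omega
    · exact ⟨b', c', a', by omega, by omega, by omega, by omega, Bb, Bc, Ba⟩
    · exact ⟨c', b', a', by omega, by omega, by omega, by omega, Bc, Bb, Ba⟩
  obtain ⟨r, h₀, h₁, h₂⟩ := h.exists_crossed_boundary hn' nonbd few many
  have hsub : idx n r - 1 = idx n (r - 1) := by
    rw [sub_eq_iff_eq_add, ← idx_add_one hn, sub_add_cancel]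
  have key : SingleBoundary (cycEdges σ) (idx n r) ∧
      s(idx n r, idx n r + 1 + 1) ∈ cycEdges σ ∧ s(idx n r + 1, idx n r - 1) ∈ cycEdges σ := by
    have h₃ : ¬ Adj σ (r - 1) r := fun h₃ =>
      h.deg h₀ h₁ (h.shift (h.symm h₃)) (by omega) (by omega) (by omega)
    have h₄ : ¬ Adj σ (r + 1) (r + 1 + 1) := fun h₄ =>
      h.deg h₂ (h.symm h₀) h₄ (by omega) (by omega) (by omega)
    rw [SingleBoundary, hsub, ← idx_add_one hn, ← idx_add_one hn]
    rw [show r + 2 = r + 1 + 1 by ring] at h₁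
    exact ⟨⟨h₀, h₃, h₄⟩, h₁, h₂⟩
  exact ⟨⟨_, key.1⟩, _, key⟩

end
end
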